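/- Let G = (V, E) be a finite directed graph with n = |V|, s, t ∈ V, and suppose every vertex u ≠ t has at least one outgoing edge. Let M(H) be the rooted Kripke model with worlds {w_v : v ∈ V} ∪ {ŵ}, relation R = {(w_u, w_v) : (u,v) ∈ E, u ≠ t} ∪ {(w_t, ŵ), (ŵ, ŵ)}, root w_s, and labeling η(w_v) = {x_v} for each v ∈ V and η(ŵ) = ∅. Then G has a Hamiltonian path from s to t if and only if there exists a connected submodel M' of M(H) with M' ⊨ AX^{n-1} x_t, where AX^{n-1} denotes the (n−1)-times iterated application of the operator AX. -/

import Mathlib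

variable {α P : Type}

/-- A rooted Kripke model: worlds `W`, transition relation `R`,
labeling `η`, and root `r`. -/
structure KripkeModel (α P : Type) where
  W : Set α
  R : α → α → Prop
  η : α → Set P
  r : α

namespace KripkeModel

/-- The structural axioms of a rooted Kripke model: `W` is nonempty, the root lies
in `W`, `R ⊆ W × W`, and `R` is total (every world has an `R`-successor). -/
def Valid (M : KripkeModel α P) : Prop :=
  M.W.Nonempty ∧ M.r ∈ M.W ∧
    (∀ u v, M.R u v → u ∈ M.W ∧ v ∈ M.W) ∧
    (∀ u ∈ M.W, ∃ v, M.R u v)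

/-- An infinite sequence (1-indexed; position `0` is ignored) is a path
if consecutive positions are `R`-related. -/
def IsPath (M : KripkeModel α P) (π : ℕ → α) : Prop :=
  ∀ i, 1 ≤ i → M.R (π i) (π (i + 1))

/-- `Π(w)`: the set of paths starting at `w` (i.e. with `π 1 = w`). -/
def Paths (M : KripkeModel α P) (w : α) : Set (ℕ → α) :=
  {π | π 1 = w ∧ M.IsPath π}

end KripkeModel

/-- CTL formulas. -/
inductive CTL (P : Type) where
  | top : CTL P
  | atom : P → CTL P
  | neg : CTL P → CTL P
  | and : CTL P → CTL P → CTL P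
  | or : CTL P → CTL P → CTL P
  | EX : CTL P → CTL P
  | AX : CTL P → CTL P
  | EF : CTL P → CTL P
  | AF : CTL P → CTL P
  | EG : CTL P → CTL P
  | AG : CTL P → CTL P
  | EU : CTL P → CTL P → CTL P
  | AU : CTL P → CTL P → CTL P
  | ER : CTL P → CTL P → CTL P
  | AR : CTL P → CTL P → CTL P

/-- CTL satisfaction `M, w ⊨ φ`. -/
def KripkeModel.Sat (M : KripkeModel α P) : CTL P → α → Prop
  | .top, _ => True
  | .atom p, w => p ∈ M.η w
  | .neg φ, w => ¬ M.Sat φ w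
  | .and φ ψ, w => M.Sat φ w ∧ M.Sat ψ w
  | .or φ ψ, w => M.Sat φ w ∨ M.Sat ψ w
  | .EX φ, w => ∃ π ∈ M.Paths w, M.Sat φ (π 2)
  | .AX φ, w => ∀ π ∈ M.Paths w, M.Sat φ (π 2)
  | .EF φ, w => ∃ π ∈ M.Paths w, ∃ k, 1 ≤ k ∧ M.Sat φ (π k)
  | .AF φ, w => ∀ π ∈ M.Paths w, ∃ k, 1 ≤ k ∧ M.Sat φ (π k)
  | .EG φ, w => ∃ π ∈ M.Paths w, ∀ k, 1 ≤ k → M.Sat φ (π k)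
  | .AG φ, w => ∀ π ∈ M.Paths w, ∀ k, 1 ≤ k → M.Sat φ (π k)
  | .EU φ ψ, w => ∃ π ∈ M.Paths w, ∃ k, 1 ≤ k ∧ M.Sat ψ (π k) ∧
      ∀ i, 1 ≤ i → i < k → M.Sat φ (π i)
  | .AU φ ψ, w => ∀ π ∈ M.Paths w, ∃ k, 1 ≤ k ∧ M.Sat ψ (π k) ∧
      ∀ i, 1 ≤ i → i < k → M.Sat φ (π i)
  | .ER φ ψ, w => ∃ π ∈ M.Paths w, ∀ k, 1 ≤ k →
      (M.Sat ψ (π k) ∨ ∃ i, 1 ≤ i ∧ i < k ∧ M.Sat φ (π i))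
  | .AR φ ψ, w => ∀ π ∈ M.Paths w, ∀ k, 1 ≤ k →
      (M.Sat ψ (π k) ∨ ∃ i, 1 ≤ i ∧ i < k ∧ M.Sat φ (π i))

/-- `M ⊨ φ`, i.e. satisfaction at the root. -/
def KripkeModel.SatRoot (M : KripkeModel α P) (φ : CTL P) : Prop :=
  M.Sat φ M.r

/-- `M'` is a connected submodel of `M`: `M'` is itself a rooted Kripke model
(nonempty world set, root, `R' ⊆ W' × W'` total), with `W' ⊆ W`, `R' ⊆ R`,
the same labeling on `W'`, the same root, and every world of `W'` reachable
from the root along a path of `M'`. -/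
def KripkeModel.IsConnectedSubmodel (M' M : KripkeModel α P) : Prop :=
  M'.Valid ∧ M'.W ⊆ M.W ∧ (∀ u v, M'.R u v → M.R u v) ∧
    (∀ w ∈ M'.W, M'.η w = M.η w) ∧ M'.r = M.r ∧
    (∀ w ∈ M'.W, ∃ π ∈ M'.Paths M'.r, ∃ i, 1 ≤ i ∧ π i = w)

/-- A Hamiltonian path from `s` to `t`: a list of vertices following edges of
`E`, starting at `s`, ending at `t`, visiting every vertex exactly once. -/
def IsHamiltonianPath {V : Type} (E : V → V → Prop) (s t : V) (l : List V) : Prop :=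
  l.Chain' E ∧ l.head? = some s ∧ l.getLast? = some t ∧ l.Nodup ∧ ∀ v : V, v ∈ l

/-- Worlds of `M(H)`: `some v` is `w_v`, and `none` is `ŵ`. -/
abbrev HamWorld (V : Type) := Option V

/-- The transition relation of `M(H)`. -/
def HamRel {V : Type} (E : V → V → Prop) (t : V) : HamWorld V → HamWorld V → Prop
  | some u, some v => E u v ∧ u ≠ t
  | some u, none => u = t
  | none, none => True
  | none, some _ => False

/-- The Kripke model `M(H)` with root `w_s`, labeling `η(w_v) = {x_v}`
(propositions are identified with vertices) and `η(ŵ) = ∅`. -/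
def HamModel {V : Type} (E : V → V → Prop) (s t : V) :
    KripkeModel (HamWorld V) V where
  W := Set.univ
  R := HamRel E t
  η := fun w => match w with
    | some v => {v}
    | none => ∅
  r := some s

/-- `AX^k`: the `k`-fold application of the operator `AX`. -/
def iterAX {P : Type} : ℕ → CTL P → CTL P
  | 0, φ => φ
  | k + 1, φ => .AX (iterAX k φ)

namespace KripkeModel

theorem Sat.atom_of_iterAX {M : KripkeModel α P} {φ : CTL P} {k : ℕ} {w : α}
    (h : M.Sat (iterAX k φ) w) {π : ℕ → α} (hπ : π ∈ M.Paths w) : M.Sat φ (π (k + 1)) := by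
  induction k generalizing w π with
  | zero => rw [zero_add, hπ.1]; exact h
  | succ k ih =>
    exact ih (h π hπ) (π := fun i => π (i + 1)) ⟨rfl, fun i _ => hπ.2 (i + 1) (by omega)⟩

/-- If the successors of `f i` are all equal to `f (i + 1)`, then `AX^k φ` holds at `f i` as soon
as `φ` holds at `f (i + k)`. -/
theorem sat_iterAX_of_deterministic {M : KripkeModel α P} {f : ℕ → α}
    (hf : ∀ i v, M.R (f i) v → v = f (i + 1)) {φ : CTL P} {k i : ℕ}
    (h : M.Sat φ (f (i + k))) : M.Sat (iterAX k φ) (f i) := by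
  induction k generalizing i with
  | zero => exact h
  | succ k ih =>
    intro π hπ
    have h2 : π 2 = f (i + 1) := hf i _ (hπ.1 ▸ hπ.2 1 le_rfl)
    rw [h2]
    exact ih (by rwa [add_right_comm])

/-- A path that visits the same world at positions `i` and `i + d` stays a path when the
segment in between is removed. -/
theorem shortcut_mem_paths {M : KripkeModel α P} {w : α} {π : ℕ → α} (hπ : π ∈ M.Paths w)
    {i d : ℕ} (hi : 1 ≤ i) (h : π i = π (i + d)) :
    (fun k => if k ≤ i then π k else π (k + d)) ∈ M.Paths w := by
  refine ⟨by simp [hi, hπ.1], fun k hk => ?_⟩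
  rcases lt_trichotomy k i with hki | rfl | hki
  · simpa [hki.le, Nat.succ_le_of_lt hki] using hπ.2 k hk
  · simpa [h, add_right_comm] using hπ.2 (k + d) (by omega)
  · simpa [hki.not_ge, show ¬ k + 1 ≤ i by omega, add_right_comm] using hπ.2 (k + d) (by omega)

end KripkeModel

section

variable {V : Type} {E : V → V → Prop} {s t : V}

theorem HamRel.eq_none_of_none {v : HamWorld V} (h : HamRel E t none v) : v = none := by
  cases v <;> simp_all [HamRel]

theorem HamRel.eq_none_of_target {v : HamWorld V} (h : HamRel E t (some t) v) : v = none := by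
  cases v <;> simp_all [HamRel]

/-- Once a sequence following `HamRel` is at the sink, it stays there. -/
theorem eq_none_of_le {π : ℕ → HamWorld V}
    (hπ : ∀ i, 1 ≤ i → HamRel E t (π i) (π (i + 1))) {i j : ℕ} (hi : 1 ≤ i) (hij : i ≤ j)
    (h : π i = none) : π j = none := by
  induction j, hij using Nat.le_induction with
  | base => exact h
  | succ j hj ih => exact HamRel.eq_none_of_none (ih ▸ hπ j (hi.trans hj))

theorem IsHamiltonianPath.length_eq_card [Fintype V] {l : List V}
    (hl : IsHamiltonianPath E s t l) : l.length = Fintype.card V := by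
  classical
  rw [← List.toFinset_card_of_nodup hl.2.2.2.1, ← Finset.card_univ]
  exact congrArg _ (Finset.eq_univ_of_forall fun v => List.mem_toFinset.2 (hl.2.2.2.2 v))

theorem List.Nodup.getElem?_succ_eq {l : List V} (hl : l.Nodup) {i j : ℕ}
    (h : l[i]? = l[j]?) : l[i + 1]? = l[j + 1]? := by
  by_cases hi : i < l.length
  · rw [(List.getElem?_inj hi hl).1 h]
  · have hj : l.length ≤ j := by
      rw [List.getElem?_eq_none (not_lt.1 hi)] at h
      exact List.getElem?_eq_none_iff.1 h.symm
    rw [List.getElem?_eq_none (by omega), List.getElem?_eq_none (by omega)]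

theorem IsHamiltonianPath.hamRel_getElem? {l : List V} (hl : IsHamiltonianPath E s t l) (i : ℕ) :
    HamRel E t l[i]? l[i + 1]? := by
  obtain ⟨hE, -, ht, hnd, -⟩ := hl
  rw [List.getLast?_eq_getElem?] at ht
  rcases lt_trichotomy (i + 1) l.length with hi | hi | hi
  · rw [List.getElem?_eq_getElem hi, List.getElem?_eq_getElem (by omega)]
    refine ⟨List.isChain_iff_getElem.1 hE i hi, fun h => ?_⟩
    have := (List.getElem?_inj (i := i) (j := l.length - 1) (by omega) hnd).1
      (by rw [ht, List.getElem?_eq_getElem (by omega), h])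
    omega
  · rw [← hi, Nat.add_sub_cancel] at ht
    rw [ht, List.getElem?_eq_none hi.ge]
    rfl
  · rw [List.getElem?_eq_none hi.le, List.getElem?_eq_none (by omega)]
    trivial

/-- The submodel of `HamModel E s t` that follows the list `l` and then stays at the sink. -/
def listModel (s : V) (l : List V) : KripkeModel (HamWorld V) V where
  W := Set.univ
  R u v := ∃ i : ℕ, u = l[i]? ∧ v = l[i + 1]?
  η w := match w with
    | some v => {v}
    | none => ∅
  r := some s

theorem IsHamiltonianPath.exists_getElem?_eq {l : List V} (hl : IsHamiltonianPath E s t l)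
    (w : HamWorld V) : ∃ i : ℕ, l[i]? = w := by
  cases w with
  | none => exact ⟨l.length, by simp⟩
  | some v => exact List.mem_iff_getElem?.1 (hl.2.2.2.2 v)

theorem IsHamiltonianPath.isConnectedSubmodel_listModel {l : List V}
    (hl : IsHamiltonianPath E s t l) :
    (listModel s l).IsConnectedSubmodel (HamModel E s t) := by
  refine ⟨⟨⟨none, trivial⟩, trivial, fun _ _ _ => ⟨trivial, trivial⟩, fun u _ => ?_⟩,
    Set.subset_univ _, ?_, fun w _ => rfl, rfl, fun w _ => ?_⟩
  · obtain ⟨i, rfl⟩ := hl.exists_getElem?_eq u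
    exact ⟨_, i, rfl, rfl⟩
  · rintro _ _ ⟨i, rfl, rfl⟩
    exact hl.hamRel_getElem? i
  · obtain ⟨i, rfl⟩ := hl.exists_getElem?_eq w
    refine ⟨fun k => l[k - 1]?, ⟨?_, fun k hk => ⟨k - 1, rfl, ?_⟩⟩, i + 1, by omega, rfl⟩
    · exact List.head?_eq_getElem?.symm.trans hl.2.1
    · change l[k + 1 - 1]? = _
      congr 1
      omega

theorem IsHamiltonianPath.satRoot_listModel [Fintype V] {l : List V}
    (hl : IsHamiltonianPath E s t l) :
    (listModel s l).SatRoot (iterAX (Fintype.card V - 1) (.atom t)) := by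
  have hdet : ∀ i v, (listModel s l).R l[i]? v → v = l[i + 1]? := by
    rintro i _ ⟨j, hj, rfl⟩
    exact hl.2.2.2.1.getElem?_succ_eq hj.symm
  have hs : (listModel s l).r = l[0]? := by
    rw [← List.head?_eq_getElem?, hl.2.1]
    rfl
  have ht : l[0 + (Fintype.card V - 1)]? = some t := by
    rw [zero_add, ← hl.length_eq_card, ← List.getLast?_eq_getElem?, hl.2.2.1]
  rw [KripkeModel.SatRoot, hs]
  refine KripkeModel.sat_iterAX_of_deterministic (f := fun i : ℕ => l[i]?) hdet ?_
  simp only [ht]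
  exact Set.mem_singleton t

/-- If every path of a connected submodel reaches `t` after exactly `|V| - 1` steps, then the
worlds on any of its paths form a Hamiltonian path. -/
theorem exists_isHamiltonianPath [Fintype V] {M : KripkeModel (HamWorld V) V}
    (hM : M.IsConnectedSubmodel (HamModel E s t))
    (hsat : M.SatRoot (iterAX (Fintype.card V - 1) (.atom t))) :
    ∃ l : List V, IsHamiltonianPath E s t l := by
  obtain ⟨⟨-, hrW, hRW, -⟩, -, hR, hη, hr, hreach⟩ := hM
  obtain ⟨π, hπ, -⟩ := hreach _ hrW
  have hcard : 0 < Fintype.card V := Fintype.card_pos_iff.2 ⟨s⟩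
  set n := Fintype.card V with hn
  have hrel {ρ : ℕ → HamWorld V} (hρ : ρ ∈ M.Paths M.r) (i : ℕ) (hi : 1 ≤ i) :
      HamRel E t (ρ i) (ρ (i + 1)) := hR _ _ (hρ.2 i hi)
  have htarget {ρ : ℕ → HamWorld V} (hρ : ρ ∈ M.Paths M.r) : ρ n = some t := by
    have h : t ∈ M.η (ρ (n - 1 + 1)) := hsat.atom_of_iterAX hρ
    rw [Nat.sub_add_cancel hcard, hη _ (hRW _ _ (hρ.2 n hcard)).1] at h
    generalize ρ n = w at h ⊢
    cases w with
    | none => exact h.elim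
    | some v => exact congrArg some (Set.mem_singleton_iff.1 h).symm
  have hafter (j : ℕ) (hj : n < j) : π j = none := by
    refine eq_none_of_le (hrel hπ) (by omega) hj (HamRel.eq_none_of_target (E := E) (t := t) ?_)
    simpa [htarget hπ] using hrel hπ n hcard
  have hsome (i : ℕ) (hi : i < n) : ∃ v, π (i + 1) = some v := by
    refine Option.ne_none_iff_exists'.1 fun h => ?_
    simpa [htarget hπ] using eq_none_of_le (hrel hπ) (by omega) hi h
  have hinj (i d : ℕ) (hi : 1 ≤ i) (hd : 1 ≤ d) (hid : i + d ≤ n) : π i ≠ π (i + d) := by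
    intro h
    have h' := htarget (KripkeModel.shortcut_mem_paths hπ hi h)
    simp [show ¬ n ≤ i by omega, hafter (n + d) (by omega)] at h'
  choose g hg using fun i : Fin n => hsome i i.2
  have hgE (i : ℕ) (hi : i + 1 < n) : E (g ⟨i, by omega⟩) (g ⟨i + 1, hi⟩) := by
    have h := hrel hπ (i + 1) (by omega)
    rw [hg ⟨i, by omega⟩, hg ⟨i + 1, hi⟩] at h
    exact h.1
  have hginj : Function.Injective g := by
    intro i j h
    by_contra hne
    wlog hij : i < j generalizing i j
    · exact this h.symm (Ne.symm hne) (lt_of_le_of_ne (not_lt.1 hij) (Ne.symm hne))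
    refine hinj (i + 1) (j - i) (by omega) (by omega) (by omega) ?_
    rw [hg i, h, ← hg j]
    congr 1
    omega
  have hgsurj : Function.Surjective g :=
    ((Fintype.bijective_iff_injective_and_card g).2 ⟨hginj, by simp [hn]⟩).2
  have hfirst : g ⟨0, hcard⟩ = s := by
    have h := hg ⟨0, hcard⟩
    rw [zero_add, hπ.1, hr] at h
    exact (Option.some.inj h).symm
  have hlast : g ⟨n - 1, by omega⟩ = t := by
    have h := hg ⟨n - 1, by omega⟩
    rw [Nat.sub_add_cancel hcard, htarget hπ] at h
    exact (Option.some.inj h).symm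
  refine ⟨List.ofFn g, List.isChain_iff_getElem.2 fun i hi => ?_, ?_, ?_,
    List.nodup_ofFn.2 hginj, fun v => (List.mem_ofFn' _ _).2 (hgsurj v)⟩
  · simpa using hgE i (by simpa using hi)
  · simp [List.head?_eq_getElem?, hcard, hfirst]
  · simp [List.getLast?_eq_getElem?, hcard, hlast]

end

/-- With `n = |V|`, `G` has a Hamiltonian path from `s` to `t` iff some connected
submodel of `M(H)` satisfies `AX^{n-1} x_t`. -/
theorem hamPath_iff_exists_submodel_AX (V : Type) [Fintype V] (E : V → V → Prop)
    (s t : V) (htotal : ∀ u : V, u ≠ t → ∃ v : V, E u v) :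
    (∃ l : List V, IsHamiltonianPath E s t l) ↔
      ∃ M' : KripkeModel (HamWorld V) V,
        M'.IsConnectedSubmodel (HamModel E s t) ∧
        M'.SatRoot (iterAX (Fintype.card V - 1) (.atom t)) := by
  constructor
  · rintro ⟨l, hl⟩
    exact ⟨listModel s l, hl.isConnectedSubmodel_listModel, hl.satRoot_listModel⟩
  · rintro ⟨M, hM, hsat⟩
    exact exists_isHamiltonianPath hM hsat
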